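/- Let a : ℝ^n → ℝ be smooth with all derivatives bounded and let u be a Schwartz function on ℝ^n. Then Re ∫_{ℝ^n} ∂_{ijk}a ∂_j ū ∂_{ik}u dx = −(1/2) Re ∫_{ℝ^n} ∂_{jk}Δa ∂_j ū ∂_k u dx, where repeated indices i,j,k are summed from 1 to n. -/

import Mathlib

open MeasureTheory Real FourierTransform Filter Topology
open scoped ENNReal NNReal

noncomputable section

abbrev Rn (n : ℕ) := EuclideanSpace ℝ (Fin n)

variable {n : ℕ}

/-- Fourier multiplier operator with symbol `m`. -/
def fmul (m : Rn n → ℂ) (f : Rn n → ℂ) : Rn n → ℂ :=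
  𝓕⁻ fun ξ => m ξ * 𝓕 f ξ

/-- The operator `|∇|^σ`. -/
def absGrad (σ : ℝ) (f : Rn n → ℂ) : Rn n → ℂ :=
  fmul (fun ξ => ((‖ξ‖ ^ σ : ℝ) : ℂ)) f

/-- Squared inhomogeneous Sobolev `H^s` norm. -/
def HsNormSq (s : ℝ) (f : Rn n → ℂ) : ℝ≥0∞ :=
  ∫⁻ ξ, ENNReal.ofReal ((1 + ‖ξ‖ ^ 2) ^ s) * (‖𝓕 f ξ‖₊ : ℝ≥0∞) ^ 2

def HsN (s : ℝ) (f : Rn n → ℂ) : ℝ≥0∞ := (HsNormSq s f) ^ ((1:ℝ)/2)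

/-- Squared homogeneous Sobolev `Ḣ^σ` norm. -/
def HdotNormSq (σ : ℝ) (f : Rn n → ℂ) : ℝ≥0∞ :=
  ∫⁻ ξ, ENNReal.ofReal (‖ξ‖ ^ (2 * σ)) * (‖𝓕 f ξ‖₊ : ℝ≥0∞) ^ 2

/-- `L^p` norm. -/
def LpN (p : ℝ) (f : Rn n → ℂ) : ℝ≥0∞ :=
  (∫⁻ x, (‖f x‖₊ : ℝ≥0∞) ^ p) ^ (1 / p)

/-- Space-time norm `L^q_t L^r_x` on a time set `I`. -/
def SpaceTimeN (q r : ℝ) (I : Set ℝ) (u : ℝ → Rn n → ℂ) : ℝ≥0∞ :=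
  (∫⁻ t in I, (LpN r (u t)) ^ q) ^ (1 / q)

/-- partial derivative in the `i`-th coordinate direction -/
def pd (i : Fin n) (f : Rn n → ℂ) (x : Rn n) : ℂ :=
  fderiv ℝ f x (EuclideanSpace.single i 1)

def pdR (i : Fin n) (f : Rn n → ℝ) (x : Rn n) : ℝ :=
  fderiv ℝ f x (EuclideanSpace.single i 1)

def lap (f : Rn n → ℂ) (x : Rn n) : ℂ := ∑ i, pd i (pd i f) x
def lapR (f : Rn n → ℝ) (x : Rn n) : ℝ := ∑ i, pdR i (pdR i f) x
def bilap (f : Rn n → ℂ) (x : Rn n) : ℂ := lap (fun y => lap f y) x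

/-- cubic nonlinearity `|u|²u` -/
def cubic (f : Rn n → ℂ) (x : Rn n) : ℂ := (‖f x‖ : ℂ) ^ 2 * f x

/-- solves the defocusing cubic fourth-order NLS on the time set `I` -/
def Solves4NLS (I : Set ℝ) (u : ℝ → Rn n → ℂ) : Prop :=
  ∀ t ∈ I, ∀ x, Complex.I * deriv (fun τ => u τ x) t + bilap (u t) x + cubic (u t) x = 0

/-- Schrödinger admissible pair -/
def SAdm (n : ℕ) (q r : ℝ) : Prop := 2 ≤ q ∧ 2 ≤ r ∧ 2 / q = n * (1/2 - 1/r)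
/-- biharmonic admissible pair -/
def BAdm (n : ℕ) (q r : ℝ) : Prop := 2 ≤ q ∧ 2 ≤ r ∧ 4 / q = n * (1/2 - 1/r)

/-- A smooth function with bounded derivatives has temperate growth. -/
theorem hasTemperateGrowth_of_bounded {a : Rn n → ℝ} (ha : ContDiff ℝ (⊤ : ℕ∞) a)
    (hbd : ∀ k : ℕ, ∃ C : ℝ, ∀ x : Rn n, ‖iteratedFDeriv ℝ k a x‖ ≤ C) :
    a.HasTemperateGrowth :=
  ⟨ha, fun k => (hbd k).elim fun C hC => ⟨0, C, by simpa using hC⟩⟩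

theorem hasTemperateGrowth_pdR {a : Rn n → ℝ} (ha : a.HasTemperateGrowth) (i : Fin n) :
    (pdR i a).HasTemperateGrowth := by
  have hfd : (fderiv ℝ a).HasTemperateGrowth := by
    refine ⟨ha.1.fderiv_right (by simp), fun k => ?_⟩
    obtain ⟨m, C, h⟩ := ha.2 (k + 1)
    exact ⟨m, C, fun x => norm_iteratedFDeriv_fderiv.trans_le (h x)⟩
  exact (ContinuousLinearMap.apply ℝ ℝ (EuclideanSpace.single i (1 : ℝ) :
    Rn n)).hasTemperateGrowth.comp hfd

theorem pdR_comm {a : Rn n → ℝ} (ha : a.HasTemperateGrowth) (i j : Fin n) :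
    pdR i (pdR j a) = pdR j (pdR i a) := by
  have key : ∀ (i j : Fin n) (x : Rn n), pdR i (pdR j a) x =
      fderiv ℝ (fderiv ℝ a) x (EuclideanSpace.single i 1) (EuclideanSpace.single j 1) := by
    intro i j x
    have hd : DifferentiableAt ℝ (fderiv ℝ a) x :=
      (ha.1.fderiv_right (m := 1) (by norm_cast)).differentiable (by simp) x
    change fderiv ℝ (fun y => fderiv ℝ a y (EuclideanSpace.single j 1)) x _ = _
    rw [fderiv_clm_apply hd (differentiableAt_const _)]
    simp
  ext x
  rw [key, key]
  exact (ha.1.contDiffAt.isSymmSndFDerivAt (by simpa using WithTop.coe_le_coe.2 (le_top : (2 : ℕ∞) ≤ ⊤))).eq _ _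

theorem pdR_sum {ι : Type*} (s : Finset ι) {f : ι → Rn n → ℝ}
    (hf : ∀ i ∈ s, (f i).HasTemperateGrowth) (k : Fin n) :
    pdR k (fun x => ∑ i ∈ s, f i x) = fun x => ∑ i ∈ s, pdR k (f i) x := by
  ext x
  simp only [pdR]
  rw [fderiv_fun_sum fun i hi => (hf i hi).1.differentiable (by simp) x]
  simp

theorem pdR_pdR_lapR {a : Rn n → ℝ} (ha : a.HasTemperateGrowth) (j k : Fin n) :
    pdR j (pdR k (lapR a)) = fun x => ∑ i, pdR i (pdR i (pdR j (pdR k a))) x := by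
  have hp := fun {b : Rn n → ℝ} (hb : b.HasTemperateGrowth) i => hasTemperateGrowth_pdR hb i
  have hlap : lapR a = fun x => ∑ i, pdR i (pdR i a) x := rfl
  rw [hlap, pdR_sum _ fun i _ => hp (hp ha i) i, pdR_sum _ fun i _ => hp (hp (hp ha i) i) k]
  ext x
  refine Finset.sum_congr rfl fun i _ => ?_
  rw [pdR_comm (hp ha i) k i, pdR_comm ha k i, pdR_comm (hp (hp ha k) i) j i,
    pdR_comm (hp ha k) j i]

/-- The coordinate partial derivative on Schwartz functions. -/
def schwartzPd (i : Fin n) (f : SchwartzMap (Rn n) ℂ) : SchwartzMap (Rn n) ℂ :=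
  LineDeriv.lineDerivOp (EuclideanSpace.single i (1 : ℝ) : Rn n) f

theorem pd_eq_schwartzPd (i : Fin n) (f : SchwartzMap (Rn n) ℂ) :
    pd i (fun y => f y) = fun y => schwartzPd i f y := rfl

theorem hasTemperateGrowth_conj (f : SchwartzMap (Rn n) ℂ) :
    (fun x => (starRingEnd ℂ) (f x)).HasTemperateGrowth :=
  Complex.conjCLE.toContinuousLinearMap.hasTemperateGrowth.comp f.hasTemperateGrowth

theorem integrable_mul_conj_mul {A : Rn n → ℝ} (hA : A.HasTemperateGrowth)
    (f g : SchwartzMap (Rn n) ℂ) :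
    Integrable fun x => (A x : ℂ) * (starRingEnd ℂ) (f x) * g x := by
  have h := (Function.Complex.hasTemperateGrowth_ofReal.comp hA).mul (hasTemperateGrowth_conj f)
  convert! (SchwartzMap.smulLeftCLM ℂ
    (Complex.ofReal ∘ A * fun x => (starRingEnd ℂ) (f x)) g).integrable (μ := volume) using 2 with x
  rw [SchwartzMap.smulLeftCLM_apply_apply h]
  simp

/-- Integration by parts against the product `A f̄ g`. -/
theorem integral_pdR_mul_conj_mul {A : Rn n → ℝ} (hA : A.HasTemperateGrowth)
    (f g : SchwartzMap (Rn n) ℂ) (i : Fin n) :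
    (∫ x, (A x : ℂ) * (starRingEnd ℂ) (f x) * schwartzPd i g x) +
      ∫ x, (A x : ℂ) * (starRingEnd ℂ) (schwartzPd i f x) * g x =
    -∫ x, (pdR i A x : ℂ) * (starRingEnd ℂ) (f x) * g x := by
  have hA' := hasTemperateGrowth_pdR hA i
  set v : Rn n := EuclideanSpace.single i (1 : ℝ)
  have hdA : ∀ x, fderiv ℝ (fun y => (A y : ℂ)) x v = (pdR i A x : ℂ) := fun x => by
    have := Complex.ofRealCLM.hasFDerivAt.comp x (hA.1.differentiable (by simp) x).hasFDerivAt
    rw [show fderiv ℝ (fun y => (A y : ℂ)) x = _ from this.fderiv]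
    rfl
  have hconj : ∀ x, HasFDerivAt (fun y => (starRingEnd ℂ) (f y))
      (Complex.conjCLE.toContinuousLinearMap.comp (fderiv ℝ f x)) x := fun x =>
    Complex.conjCLE.toContinuousLinearMap.hasFDerivAt.comp x f.differentiableAt.hasFDerivAt
  have hprod := fun x => (hconj x).mul (g.differentiableAt (x := x)).hasFDerivAt
  have hdfg : ∀ x, fderiv ℝ (fun y => (starRingEnd ℂ) (f y) * g y) x v =
      (starRingEnd ℂ) (f x) * schwartzPd i g x + (starRingEnd ℂ) (schwartzPd i f x) * g x := by
    intro x
    rw [show fderiv ℝ (fun y => (starRingEnd ℂ) (f y) * g y) x = _ from (hprod x).fderiv]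
    simp [schwartzPd, SchwartzMap.lineDerivOp_apply_eq_fderiv, v, mul_comm]
  have h₁ := integrable_mul_conj_mul hA f (schwartzPd i g)
  have h₂ := integrable_mul_conj_mul hA (schwartzPd i f) g
  have hibp := integral_mul_fderiv_eq_neg_fderiv_mul_of_integrable (μ := volume)
    (f := fun x => (A x : ℂ)) (g := fun x => (starRingEnd ℂ) (f x) * g x) (v := v)
    (by simpa only [hdA, mul_assoc] using integrable_mul_conj_mul hA' f g)
    (by simpa only [hdfg, mul_add, mul_assoc] using! h₁.add h₂)
    (by simpa only [mul_assoc] using integrable_mul_conj_mul hA f g)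
    (fun x _ => (Function.Complex.hasTemperateGrowth_ofReal.comp hA).1.differentiable (by simp) x)
    (fun x _ => (hprod x).differentiableAt)
  rw [← integral_add h₁ h₂]
  simpa only [hdA, hdfg, mul_add, mul_assoc] using hibp

/-- Real part of the integrated product rule for `A f̄ g`, with the two terms in the same form. -/
theorem re_integral_pdR_mul_conj_mul {A : Rn n → ℝ} (hA : A.HasTemperateGrowth)
    (f g : SchwartzMap (Rn n) ℂ) (i : Fin n) :
    (∫ x, (A x : ℂ) * (starRingEnd ℂ) (f x) * schwartzPd i g x).re +
      (∫ x, (A x : ℂ) * (starRingEnd ℂ) (g x) * schwartzPd i f x).re =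
    -(∫ x, (pdR i A x : ℂ) * (starRingEnd ℂ) (f x) * g x).re := by
  have hconj : ∫ x, (A x : ℂ) * (starRingEnd ℂ) (schwartzPd i f x) * g x =
      (starRingEnd ℂ) (∫ x, (A x : ℂ) * (starRingEnd ℂ) (g x) * schwartzPd i f x) := by
    rw [← integral_conj]
    congr 1 with x
    simp only [map_mul, Complex.conj_ofReal, Complex.conj_conj]
    ring
  have h := congrArg Complex.re (integral_pdR_mul_conj_mul hA f g i)
  rwa [hconj, Complex.add_re, Complex.neg_re, Complex.conj_re] at h

/-- third-derivative symmetrization identity. -/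
theorem stmt_7 (n : ℕ) (a : Rn n → ℝ)
    (ha : ContDiff ℝ (⊤ : ℕ∞) a)
    (hbd : ∀ k : ℕ, ∃ C : ℝ, ∀ x : Rn n, ‖iteratedFDeriv ℝ k a x‖ ≤ C)
    (u : SchwartzMap (Rn n) ℂ) :
    (∫ x : Rn n,
        ∑ i, ∑ j, ∑ k, (pdR i (pdR j (pdR k a)) x : ℂ) *
          (starRingEnd ℂ) (pd j (fun y => u y) x) * pd i (pd k (fun y => u y)) x).re =
      -(1/2 : ℝ) * (∫ x : Rn n,
        ∑ j, ∑ k, (pdR j (pdR k (lapR a)) x : ℂ) *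
          (starRingEnd ℂ) (pd j (fun y => u y) x) * pd k (fun y => u y) x).re := by
  have hta := hasTemperateGrowth_of_bounded ha hbd
  have hp := fun {b : Rn n → ℝ} (hb : b.HasTemperateGrowth) i => hasTemperateGrowth_pdR hb i
  have hA := fun i j k => hp (hp (hp hta k) j) i
  simp only [pdR_pdR_lapR hta, pd_eq_schwartzPd, Complex.ofReal_sum, Finset.sum_mul]
  have hL := fun i j k =>
    integrable_mul_conj_mul (hA i j k) (schwartzPd j u) (schwartzPd i (schwartzPd k u))
  have hR := fun i j k =>
    integrable_mul_conj_mul (hp (hA i j k) i) (schwartzPd j u) (schwartzPd k u)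
  rw [integral_finsetSum _ fun i _ => integrable_finsetSum _ fun j _ =>
      integrable_finsetSum _ fun k _ => hL i j k,
    integral_finsetSum _ fun j _ => integrable_finsetSum _ fun k _ =>
      integrable_finsetSum _ fun i _ => hR i j k]
  simp only [integral_finsetSum _ fun j _ => integrable_finsetSum _ fun k _ => hL _ j k,
    integral_finsetSum _ fun k _ => hL _ _ k,
    integral_finsetSum _ fun k _ => integrable_finsetSum _ fun i _ => hR i _ k,
    integral_finsetSum _ fun i _ => hR i _ _, Complex.re_sum]
  set S : Fin n → Fin n → Fin n → ℝ := fun i j k => (∫ x, (pdR i (pdR j (pdR k a)) x : ℂ) *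
    (starRingEnd ℂ) (schwartzPd j u x) * schwartzPd i (schwartzPd k u) x).re
  set R : Fin n → Fin n → Fin n → ℝ := fun i j k => (∫ x,
    (pdR i (pdR i (pdR j (pdR k a))) x : ℂ) *
    (starRingEnd ℂ) (schwartzPd j u x) * schwartzPd k u x).re
  have hSR : ∀ i j k, S i j k + S i k j = -R i j k := fun i j k => by
    have h := re_integral_pdR_mul_conj_mul (hA i j k) (schwartzPd j u) (schwartzPd k u) i
    simpa only [S, R, pdR_comm hta k j] using h
  change ∑ i, ∑ j, ∑ k, S i j k = -(1 / 2 : ℝ) * ∑ j, ∑ k, ∑ i, R i j k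
  have hswap : ∑ i, ∑ j, ∑ k, S i j k = ∑ i, ∑ j, ∑ k, S i k j :=
    Finset.sum_congr rfl fun i _ => Finset.sum_comm
  have hcyc : ∑ j, ∑ k, ∑ i, R i j k = ∑ i, ∑ j, ∑ k, R i j k := by
    rw [Finset.sum_comm_cycle]
  have hsum : ∑ i, ∑ j, ∑ k, S i j k + ∑ i, ∑ j, ∑ k, S i k j = -∑ i, ∑ j, ∑ k, R i j k := by
    simp only [← Finset.sum_add_distrib, hSR, Finset.sum_neg_distrib]
  rw [hcyc]
  linarith
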